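/- Fix integers k ≥ 2 and n ≥ 3. Let G' be a graph with χ(G') > kn - 1 and let G be obtained from G' ⊔ K_n by replacing every edge with the gadget (K; a, b). Then G admits no (kn-1, k)-coloring; hence χ_c(G) > n - 1/k. -/

import Mathlib

/-- A `(p,q)`-circular coloring of `G`: colors in `{0,…,p-1}` with
`q ≤ |c x - c y| ≤ p - q` on every edge. -/
def IsCircColoring {V : Type*} (G : SimpleGraph V) (p q : ℕ) (c : V → ℕ) : Prop :=
  (∀ v, c v < p) ∧ ∀ ⦃x y⦄, G.Adj x y →
    (q : ℤ) ≤ |(c x : ℤ) - (c y : ℤ)| ∧ |(c x : ℤ) - (c y : ℤ)| ≤ (p : ℤ) - (q : ℤ)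

/-- The circular chromatic number: `inf { p/q : G has a (p,q)-coloring }`. -/
noncomputable def circChrom {V : Type*} (G : SimpleGraph V) : ℝ :=
  sInf {r : ℝ | ∃ p q : ℕ, 0 < p ∧ 0 < q ∧ r = (p : ℝ) / (q : ℝ) ∧
    ∃ c : V → ℕ, IsCircColoring G p q c}

/-- The arc relation of the digraph `D_c(G)` associated to a `(p,q)`-coloring `c`:
an arc `x → y` for every edge `xy` with `c y - c x ≡ q (mod p)`. -/
def DArc {V : Type*} (G : SimpleGraph V) (p q : ℕ) (c : V → ℕ) (x y : V) : Prop :=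
  G.Adj x y ∧ ((c y : ℤ) - (c x : ℤ)) % (p : ℤ) = (q : ℤ) % (p : ℤ)

/-- A relation (digraph) is acyclic: no directed cycle, i.e. no vertex reaches
itself by a nontrivial directed path. -/
def Acyclic {V : Type*} (R : V → V → Prop) : Prop :=
  ∀ v, ¬ Relation.TransGen R v v

/-- A `(p,1)`-coloring viewed as a proper coloring with colors in `ZMod p`. -/
def IsProperZ {V : Type*} (p : ℕ) (G : SimpleGraph V) (c : V → ZMod p) : Prop :=
  ∀ ⦃x y⦄, G.Adj x y → c x ≠ c y

/-- Arc relation of `D_c(G)` for a `(p,1)`-coloring with colors in `ZMod p`: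
an arc `x → y` for every edge `xy` with `c y - c x = 1`. -/
def ZArc {V : Type*} {p : ℕ} (G : SimpleGraph V) (c : V → ZMod p) (x y : V) : Prop :=
  G.Adj x y ∧ c y - c x = 1

/-- `K⁻`: the complete graph on `{0,1,2,3}` (with `v₁ = 0`, `v₂ = 1`, `v₃ = 2`,
`v₄ = 3`) minus the edge `{0,1}`. -/
def Kminus : SimpleGraph (Fin 4) :=
  SimpleGraph.fromRel (fun x y => ¬((x = 0 ∧ y = 1) ∨ (x = 1 ∧ y = 0)))

/-- Edge list of the gadget `H`: vertices `a = 0`, `b = 1`, `c = 2`, `d = 3`,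
and four copies of `K⁻` with terminal pairs `(a,d), (d,b), (b,c), (c,a)` whose
internal vertex pairs are `(4,5), (6,7), (8,9), (10,11)`, together with the
edges `ad, db, bc, ca`. -/
def HEdges : List (Fin 12 × Fin 12) :=
  [(0,4),(0,5),(3,4),(3,5),(4,5),
   (3,6),(3,7),(1,6),(1,7),(6,7),
   (1,8),(1,9),(2,8),(2,9),(8,9),
   (2,10),(2,11),(0,10),(0,11),(10,11),
   (0,3),(3,1),(1,2),(2,0)]

/-- The gadget graph `H`. -/
def HGraph : SimpleGraph (Fin 12) :=
  SimpleGraph.fromRel (fun x y => (x, y) ∈ HEdges)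

/-- The gadget graph `K` for parameters `k, n`: vertices `a = 0`, `b = 1`, and
`vᵢ = i + 1` for `1 ≤ i ≤ n - 1`; the `vᵢ` form a clique, `a` is adjacent to
`v₁, …, v_{n-2}` and `b` is adjacent to `v_{n-1}`. -/
def Kgadget (n : ℕ) : SimpleGraph (Fin (n + 1)) :=
  SimpleGraph.fromRel (fun x y =>
    (2 ≤ x.val ∧ 2 ≤ y.val) ∨ (x.val = 0 ∧ 2 ≤ y.val ∧ y.val ≤ n - 1) ∨
      (x.val = 1 ∧ y.val = n))

/-- `o` orients every edge of `G'` (chooses exactly one direction for each edge). -/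
def Orients {V : Type*} (G' : SimpleGraph V) (o : V → V → Prop) : Prop :=
  ∀ ⦃u v⦄, G'.Adj u v → (o u v ↔ ¬ o v u)

/-- The graph obtained from `G'` by replacing every edge `uv` (oriented by `o`)
by a copy of the gadget `(Hg; ta, tb)`: `u` is identified with `ta`, `v` with
`tb`, and the internal vertices of the copy for the edge `uv` are the vertices
`(u, v, i)`. -/
def replaceEdges {V W : Type*} (G' : SimpleGraph V) (o : V → V → Prop)
    (Hg : SimpleGraph W) (ta tb : W) :
    SimpleGraph (V ⊕ (V × V × {w : W // w ≠ ta ∧ w ≠ tb})) :=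
  SimpleGraph.fromRel (fun z w =>
    match z, w with
    | Sum.inl u, Sum.inl v => G'.Adj u v ∧ Hg.Adj ta tb
    | Sum.inl u, Sum.inr (x, y, i) =>
        G'.Adj x y ∧ o x y ∧ ((u = x ∧ Hg.Adj ta i.1) ∨ (u = y ∧ Hg.Adj tb i.1))
    | Sum.inr (x, y, i), Sum.inr (x', y', j) =>
        x = x' ∧ y = y' ∧ G'.Adj x y ∧ o x y ∧ Hg.Adj i.1 j.1
    | _, _ => False)

/-- Disjoint union of two simple graphs. -/
def disjUnion {V W : Type*} (G : SimpleGraph V) (H : SimpleGraph W) :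
    SimpleGraph (V ⊕ W) :=
  SimpleGraph.fromRel (fun z w =>
    match z, w with
    | Sum.inl a, Sum.inl b => G.Adj a b
    | Sum.inr a, Sum.inr b => H.Adj a b
    | _, _ => False)

/-- Cyclic arc of length `L` starting at `x` in `{0,…,p-1}`. -/
def cycArc (p x L : ℕ) : Finset ℕ :=
  (Finset.range p).filter (fun y => (x ≤ y ∧ y < x + L) ∨ y + p < x + L)

theorem mem_cycArc {p x L y : ℕ} :
    y ∈ cycArc p x L ↔ y < p ∧ ((x ≤ y ∧ y < x + L) ∨ y + p < x + L) := by
  simp [cycArc]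

theorem card_cycArc {p x L : ℕ} (hx : x < p) (hL : L ≤ p) : (cycArc p x L).card = L := by
  have h : cycArc p x L = Finset.Ico x (min (x + L) p) ∪ Finset.Ico 0 (x + L - p) := by
    ext y
    simp only [mem_cycArc, Finset.mem_union, Finset.mem_Ico]
    omega
  rw [h, Finset.card_union_of_disjoint]
  · simp only [Nat.card_Ico]
    omega
  · rw [Finset.disjoint_left]
    intro y
    simp only [Finset.mem_Ico]
    omega

/-- Circular separation. -/
def CSep (p : ℕ) (q : ℤ) (x y : ℕ) : Prop :=
  q ≤ |(x : ℤ) - (y : ℤ)| ∧ |(x : ℤ) - (y : ℤ)| ≤ (p : ℤ) - q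

theorem CSep.disj {p q x y : ℕ} (h : CSep p q x y) (hx : x < p) (hy : y < p) :
    ∀ z, z ∈ cycArc p x q → z ∈ cycArc p y q → False := by
  intro z
  obtain ⟨h1, h2⟩ := h
  simp only [mem_cycArc]
  rcases abs_cases ((x : ℤ) - (y : ℤ)) with ⟨h3, _⟩ | ⟨h3, _⟩ <;> rw [h3] at h1 h2 <;> omega

theorem pack {ι : Type*} [Fintype ι] (p q : ℕ) (hqp : q ≤ p) (f : ι → ℕ) (a b : ℕ)
    (hf : ∀ i, f i < p) (ha : a < p) (hb : b < p)
    (hff : ∀ i j, i ≠ j → CSep p q (f i) (f j))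
    (hfab : ∀ i, CSep p q (f i) a ∨ CSep p q (f i) b) :
    CSep p ((Fintype.card ι : ℤ) * q + q - p) a b := by
  classical
  set U := Finset.univ.biUnion (fun i => cycArc p (f i) q) with hU
  have hUc : U.card = Fintype.card ι * q := by
    rw [hU, Finset.card_biUnion]
    · rw [Finset.sum_congr rfl (fun i _ => card_cycArc (hf i) hqp)]
      simp
    · intro i _ j _ hij
      rw [Function.onFun, Finset.disjoint_left]
      exact fun z => (hff i j hij).disj (hf i) (hf j) z
  have key : ∀ x L, x < p → L ≤ p → (∀ z, z ∈ cycArc p x L → z ∈ cycArc p a q ∧ z ∈ cycArc p b q) →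
      Fintype.card ι * q + L ≤ p := by
    intro x L hx hL hsub
    rw [← hUc, ← card_cycArc hx hL, ← Finset.card_union_of_disjoint]
    · calc _ ≤ (Finset.range p).card := by
            apply Finset.card_le_card
            intro z
            simp only [Finset.mem_union, hU, Finset.mem_biUnion, Finset.mem_range, mem_cycArc]
            rintro (⟨_, _, h, _⟩ | ⟨h, _⟩) <;> exact h
        _ = p := by simp
    · rw [Finset.disjoint_left]
      intro z hz hz'
      obtain ⟨i, _, hi⟩ := Finset.mem_biUnion.1 hz
      rcases hfab i with h | h
      · exact h.disj (hf i) ha z hi (hsub z hz').1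
      · exact h.disj (hf i) hb z hi (hsub z hz').2
  have k1 : ∀ e x, x < p →
      (∀ z, z ∈ cycArc p x (q - e) → z ∈ cycArc p a q ∧ z ∈ cycArc p b q) →
      (Fintype.card ι : ℤ) * q + q - p ≤ e := by
    intro e x hx hs
    have := key x (q - e) hx (by omega) hs
    zify at this
    have h2 : (q : ℤ) - e ≤ ((q - e : ℕ) : ℤ) := by omega
    linarith
  rcases le_total a b with hab | hab
  · have e1 := k1 (b - a) b hb (by intro z; simp only [mem_cycArc]; omega)
    have e2 := k1 (p - (b - a)) a ha (by intro z; simp only [mem_cycArc]; omega)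
    have : |(a : ℤ) - b| = b - a := by rw [abs_sub_comm, abs_of_nonneg]; omega
    rw [CSep, this]
    omega
  · have e1 := k1 (a - b) a ha (by intro z; simp only [mem_cycArc]; omega)
    have e2 := k1 (p - (a - b)) b hb (by intro z; simp only [mem_cycArc]; omega)
    have : |(a : ℤ) - b| = a - b := by rw [abs_of_nonneg]; omega
    rw [CSep, this]
    omega

theorem round_col {W : Type*} [Fintype W] (H : SimpleGraph W) (p d m s : ℕ) (hd : 0 < d)
    (c : W → ℕ) (hc : ∀ x, c x < p) (hadj : ∀ x y, H.Adj x y → CSep p d (c x) (c y))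
    (hp : p ≤ m * d + s) (hs : Fintype.card W * s < p) : H.Colorable m := by
  classical
  have hsp : ∀ _ : W, s < p := by
    intro x
    have : 0 < Fintype.card W := Fintype.card_pos_iff.2 ⟨x⟩
    nlinarith
  obtain ⟨t, ht, hfree⟩ : ∃ t, t < p ∧ ∀ x, t ∉ cycArc p (c x) s := by
    by_contra! hcon
    have h1 : Finset.range p ⊆ Finset.univ.biUnion (fun x => cycArc p (c x) s) := by
      intro t ht
      obtain ⟨x, hx⟩ := hcon t (Finset.mem_range.1 ht)
      exact Finset.mem_biUnion.2 ⟨x, Finset.mem_univ _, hx⟩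
    have h2 := (Finset.card_le_card h1).trans Finset.card_biUnion_le
    rw [Finset.sum_congr rfl (fun x _ => card_cycArc (hc x) (hsp x).le)] at h2
    simp at h2
    omega
  set g : W → ℕ := fun x => if c x ≤ t then t - c x - s else t + p - c x - s with hg
  have hfree' : ∀ x, (c x ≤ t ∧ g x + s + c x = t) ∨ (t < c x ∧ g x + s + c x = t + p) := by
    intro x
    have h1 := hfree x
    have h2 := hc x
    have h3 := hsp x
    simp only [mem_cycArc] at h1
    simp only [hg]
    split_ifs <;> omega
  have hlt : ∀ x, g x / d < m := by
    intro x
    rw [Nat.div_lt_iff_lt_mul hd]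
    have := hfree' x
    have := hc x
    omega
  refine ⟨SimpleGraph.Coloring.mk (fun x => (⟨g x / d, hlt x⟩ : Fin m)) ?_⟩
  intro x y hxy heq
  have heq' : g x / d = g y / d := by simpa using heq
  obtain ⟨h1, h2⟩ := hadj x y hxy
  have e1 := hfree' x
  have e2 := hfree' y
  have a1 := Nat.div_add_mod (g x) d
  have a2 := Nat.div_add_mod (g y) d
  have b1 := Nat.mod_lt (g x) hd
  have b2 := Nat.mod_lt (g y) hd
  rw [heq'] at a1
  rcases abs_cases ((c x : ℤ) - (c y : ℤ)) with ⟨h3, _⟩ | ⟨h3, _⟩ <;> rw [h3] at h1 h2 <;> omega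

theorem replace_sep {V : Type*} (n p q : ℕ) (hn : 3 ≤ n) (G : SimpleGraph V)
    (o : V → V → Prop) (c) (hc : IsCircColoring (replaceEdges G o (Kgadget n) 0 1) p q c)
    (u v : V) (huv : G.Adj u v) (ho : o u v) :
    CSep p ((n : ℤ) * q - p) (c (Sum.inl u)) (c (Sum.inl v)) := by
  obtain ⟨hc1, hc2⟩ := hc
  have h0 : ((0 : Fin (n + 1)) : ℕ) = 0 := rfl
  have h1 : ((1 : Fin (n + 1)) : ℕ) = 1 := by
    rw [Fin.val_one']; exact Nat.mod_eq_of_lt (by omega)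
  have hi : ∀ i : {w : Fin (n + 1) // w ≠ 0 ∧ w ≠ 1}, 2 ≤ i.1.val := by
    intro i
    have := i.2
    simp only [ne_eq, Fin.ext_iff, h0, h1] at this
    omega
  have hff : ∀ i j : {w : Fin (n + 1) // w ≠ 0 ∧ w ≠ 1}, i ≠ j →
      CSep p q (c (Sum.inr (u, v, i))) (c (Sum.inr (u, v, j))) := by
    intro i j hij
    apply hc2
    have hij' : i.1 ≠ j.1 := fun h => hij (Subtype.ext h)
    simp [replaceEdges, hij, huv, ho, Kgadget, hij', hi]
  have hqp : q ≤ p := by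
    have := (hff ⟨⟨2, by omega⟩, by simp only [ne_eq, Fin.ext_iff, h0, h1]; omega⟩
      ⟨⟨3, by omega⟩, by simp only [ne_eq, Fin.ext_iff, h0, h1]; omega⟩ (by simp))
    obtain ⟨h2, h3⟩ := this
    omega
  have hcard : Fintype.card {w : Fin (n + 1) // w ≠ 0 ∧ w ≠ 1} = n - 1 := by
    have h01 : (0 : Fin (n + 1)) ≠ 1 := by simp only [ne_eq, Fin.ext_iff, h0, h1]; omega
    have : (Finset.univ.filter (fun w : Fin (n + 1) => w ≠ 0 ∧ w ≠ 1)) =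
        (Finset.univ.erase 0).erase 1 := by
      ext w; simp [and_comm]
    rw [Fintype.card_subtype, this, Finset.card_erase_of_mem, Finset.card_erase_of_mem] <;>
      simp [h01.symm]
  have := pack p q hqp (fun i : {w : Fin (n + 1) // w ≠ 0 ∧ w ≠ 1} => c (Sum.inr (u, v, i)))
    (c (Sum.inl u)) (c (Sum.inl v)) (fun i => hc1 _) (hc1 _) (hc1 _) hff ?_
  · rw [hcard] at this
    have e : (n : ℤ) * q - p = ((n - 1 : ℕ) : ℤ) * q + q - p := by
      rw [Nat.cast_sub (by omega)]; push_cast; ring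
    rw [e]; exact this
  · intro i
    have hi2 := hi i
    have hne0 : (0 : Fin (n + 1)) ≠ i.1 := i.2.1.symm
    have hne1 : (1 : Fin (n + 1)) ≠ i.1 := i.2.2.symm
    by_cases hin : i.1.val = n
    · right
      apply hc2
      have : (Kgadget n).Adj 1 i.1 := by
        simp only [Kgadget, SimpleGraph.fromRel_adj]
        exact ⟨hne1, Or.inl (Or.inr (Or.inr ⟨h1, hin⟩))⟩
      simp [replaceEdges, huv, ho, this]
    · left
      apply hc2
      have : (Kgadget n).Adj 0 i.1 := by
        simp only [Kgadget, SimpleGraph.fromRel_adj]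
        have := i.1.isLt
        exact ⟨hne0, Or.inl (Or.inr (Or.inl ⟨h0, hi2, by omega⟩))⟩
      simp [replaceEdges, huv, ho, this]

theorem replace_col {V : Type*} (n : ℕ) (hn : 3 ≤ n) (G : SimpleGraph V)
    (o : V → V → Prop) : ∃ c, IsCircColoring (replaceEdges G o (Kgadget n) 0 1) n 1 c := by
  have h0 : ((0 : Fin (n + 1)) : ℕ) = 0 := rfl
  have h1 : ((1 : Fin (n + 1)) : ℕ) = 1 := by
    rw [Fin.val_one']; exact Nat.mod_eq_of_lt (by omega)
  have hi : ∀ i : {w : Fin (n + 1) // w ≠ 0 ∧ w ≠ 1}, 2 ≤ i.1.val ∧ i.1.val ≤ n := by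
    intro i
    have := i.2
    simp only [ne_eq, Fin.ext_iff, h0, h1] at this
    omega
  have h01 : ¬ (Kgadget n).Adj 0 1 := by
    simp only [Kgadget, SimpleGraph.fromRel_adj, h0, h1]
    omega
  let c : V ⊕ (V × V × {w : Fin (n + 1) // w ≠ 0 ∧ w ≠ 1}) → ℕ :=
    Sum.elim (fun _ => 0) (fun z => z.2.2.1.val - 1)
  have hcn : ∀ z, c z < n := by
    rintro (u | ⟨x, y, i⟩)
    · simp [c]; omega
    · have := hi i
      simp [c]; omega
  refine ⟨c, hcn, ?_⟩
  intro z w hzw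
  have hne : c z ≠ c w := by
    rcases z with u | ⟨x, y, i⟩ <;> rcases w with u' | ⟨x', y', j⟩
    · simp [replaceEdges, h01] at hzw
    · have := hi j
      simp [c]; omega
    · have := hi i
      simp [c]; omega
    · have a1 := hi i
      have a2 := hi j
      have hij : i.1.val ≠ j.1.val := by
        intro h
        have h' : i.1 = j.1 := Fin.ext h
        simp [replaceEdges, h'] at hzw
      simp [c]; omega
  have := hcn z
  have := hcn w
  rcases abs_cases ((c z : ℤ) - (c w : ℤ)) with ⟨h3, _⟩ | ⟨h3, _⟩ <;> rw [h3] <;> omega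

theorem CSep.symm {p : ℕ} {q : ℤ} {x y : ℕ} (h : CSep p q x y) : CSep p q y x := by
  unfold CSep at *
  rwa [abs_sub_comm]

/-- for `k ≥ 2`, `n ≥ 3`, if `χ(G') > kn - 1` and `G` is
obtained from `G' ⊔ K_n` by replacing every edge by `(K; a, b)`, then `G` has
no `(kn-1, k)`-coloring, hence `χ_c(G) > n - 1/k`. -/
theorem stmt_19 {V : Type*} (k n : ℕ) (hk : 2 ≤ k) (hn : 3 ≤ n)
    (G' : SimpleGraph V) (o : V ⊕ Fin n → V ⊕ Fin n → Prop)
    (ho : Orients (disjUnion G' (⊤ : SimpleGraph (Fin n))) o)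
    (h : ¬ G'.Colorable (k * n - 1)) :
    (¬ ∃ c, IsCircColoring
        (replaceEdges (disjUnion G' (⊤ : SimpleGraph (Fin n))) o (Kgadget n) 0 1)
        (k * n - 1) k c) ∧
    (n : ℝ) - 1 / (k : ℝ) < circChrom
        (replaceEdges (disjUnion G' (⊤ : SimpleGraph (Fin n))) o (Kgadget n) 0 1) := by
  have hkn : 6 ≤ k * n := by nlinarith
  have hk0 : (0 : ℝ) < k := by positivity
  have hn0 : (3 : ℝ) ≤ n := by exact_mod_cast hn
  have main : (n : ℝ) - 1 / (k : ℝ) < circChrom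
        (replaceEdges (disjUnion G' (⊤ : SimpleGraph (Fin n))) o (Kgadget n) 0 1) := by
    by_contra! hle
    apply h
    refine SimpleGraph.nonempty_hom_of_forall_finite_subgraph_hom ?_
    intro F hF
    suffices hsuff : F.coe.Colorable (k * n - 1) from hsuff.some
    have : Fintype F.verts := hF.fintype
    set N := Fintype.card F.verts with hN
    have hε : (0 : ℝ) < 1 / (n * k * (N + 1)) := by positivity
    obtain ⟨r, ⟨p, q, hp, hq, rfl, c, hc⟩, hr⟩ := exists_lt_of_csInf_lt
      (by
        obtain ⟨c, hc⟩ := replace_col n hn (disjUnion G' (⊤ : SimpleGraph (Fin n))) o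
        exact ⟨_, n, 1, by omega, one_pos, rfl, c, hc⟩)
      (lt_of_le_of_lt hle (lt_add_of_pos_right _ hε))
    have hq0 : (0 : ℝ) < q := by exact_mod_cast hq
    -- integer form of the bound
    have hbound : (N + 1) * (n * k * p) + 0 < (N + 1) * (n * (k * n - 1) * q) + q := by
      have h2 : (k * n - 1 : ℕ) = (k : ℝ) * n - 1 := by
        rw [Nat.cast_sub (by omega)]; push_cast; ring
      rw [div_lt_iff₀ hq0] at hr
      have h3 : ((N : ℝ) + 1) * (n * k * p) < (N + 1) * (n * (k * n - 1) * q) + q := by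
        have h4 : (0 : ℝ) < (N + 1) * (n * k) := by positivity
        have h5 := mul_lt_mul_of_pos_left hr h4
        have h6 : ((N : ℝ) + 1) * (n * k) * ((n - 1 / k + 1 / (n * k * (N + 1))) * q)
            = (N + 1) * (n * (k * n - 1) * q) + q := by
          field_simp
        rw [h6] at h5
        linarith
      have h7 : (((N + 1) * (n * k * p) + 0 : ℕ) : ℝ)
          < (((N + 1) * (n * (k * n - 1) * q) + q : ℕ) : ℝ) := by
        push_cast
        rw [h2]
        linarith
      exact_mod_cast h7
    obtain ⟨m, hm⟩ : ∃ m, k * n = m + 1 := ⟨k * n - 1, by omega⟩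
    have hm' : k * n - 1 = m := by omega
    rw [hm'] at hbound ⊢
    have hpn : p < n * q := by
      by_contra! hcon
      have e1 : (N + 1) * (n * k * (n * q)) ≤ (N + 1) * (n * k * p) := by gcongr
      have e2 : (N + 1) * (n * k * (n * q)) = (N + 1) * (n * m * q) + (N + 1) * (n * q) := by
        calc _ = (N + 1) * (n * (k * n) * q) := by ring
          _ = _ := by rw [hm]; ring
      have e3 : q ≤ (N + 1) * (n * q) := by nlinarith [Nat.zero_le (N * (n * q))]
      omega
    obtain ⟨d, hd⟩ : ∃ d, n * q = p + d := ⟨n * q - p, by omega⟩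
    have hd0 : 0 < d := by omega
    have hdi : (n : ℤ) * q - p = d := by
      have : ((n * q : ℕ) : ℤ) = ((p + d : ℕ) : ℤ) := by rw [hd]
      push_cast at this
      linarith
    have hsep : ∀ x y : V, G'.Adj x y →
        CSep p d (c (Sum.inl (Sum.inl x))) (c (Sum.inl (Sum.inl y))) := by
      intro x y hxy
      have hA : (disjUnion G' (⊤ : SimpleGraph (Fin n))).Adj (Sum.inl x) (Sum.inl y) := by
        simp [disjUnion, hxy, hxy.ne]
      rw [← hdi]
      by_cases hoo : o (Sum.inl x) (Sum.inl y)
      · exact replace_sep n p q hn _ o c hc _ _ hA hoo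
      · have : o (Sum.inl y) (Sum.inl x) := by
          have := ho hA
          tauto
        exact (replace_sep n p q hn _ o c hc _ _ hA.symm this).symm
    -- `s = p - m d`
    have hmd : m * d + n * k * p = n * m * q + p := by
      have e1 : m * (n * q) = m * (p + d) := by rw [hd]
      have e2 : n * k * p = (m + 1) * p := by rw [← hm]; ring
      rw [e2]; linarith
    have hres : F.coe.Colorable m := by
      refine round_col F.coe p d m (p - m * d) hd0 (fun x => c (Sum.inl (Sum.inl x.1)))
        (fun x => hc.1 _) (fun x y hxy => hsep _ _ (F.adj_sub hxy)) (by omega) ?_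
      rw [← hN]
      rcases le_total p (m * d) with hpd | hpd
      · rw [Nat.sub_eq_zero_of_le hpd]; omega
      · obtain ⟨s, hs⟩ := Nat.exists_eq_add_of_le hpd
        have hs' : p - m * d = s := by omega
        rw [hs']
        have e1 : n * k * p = n * m * q + s := by omega
        rw [e1] at hbound
        have e2 : (N + 1) * s < q := by
          have : (N + 1) * (n * m * q + s) = (N + 1) * (n * m * q) + (N + 1) * s := by ring
          omega
        have e3 : q ≤ p := by
          have h6 : n * k * q ≤ n * k * p := by
            rw [e1]
            have : n * k ≤ n * m := by
              apply Nat.mul_le_mul_left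
              nlinarith
            have := Nat.mul_le_mul_right q this
            omega
          exact Nat.le_of_mul_le_mul_left h6 (by positivity)
        nlinarith
    exact hres
  refine ⟨?_, main⟩
  rintro ⟨c, hc⟩
  have hle : circChrom
        (replaceEdges (disjUnion G' (⊤ : SimpleGraph (Fin n))) o (Kgadget n) 0 1)
      ≤ ((k * n - 1 : ℕ) : ℝ) / (k : ℝ) := by
    apply csInf_le
    · refine ⟨0, ?_⟩
      rintro r ⟨p, q, _, _, rfl, _⟩
      positivity
    · exact ⟨k * n - 1, k, by omega, by omega, rfl, c, hc⟩
  have h2 : ((k * n - 1 : ℕ) : ℝ) / (k : ℝ) = n - 1 / k := by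
    rw [Nat.cast_sub (by omega)]; push_cast; field_simp
  rw [h2] at hle
  exact absurd main (not_lt.2 hle)
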